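/- Let p ∈ {2,3,5}, k ∈ {4,6,8,10,14}, and ε ≥ 0. Assume v_p(a_k(a,b)) ≥ ε for all positive integers a, b with p | a and p ∤ b. Then for all m, n coprime to p and r, s ≥ 0: if r > s then v_p(a_k(m p^r, n p^s)) ≥ ε, and if r < s then v_p(a_k(m p^r, n p^s)) ≥ (s-r)(k-1) + ε. -/

import Mathlib

open UpperHalfPlane Complex CongruenceSubgroup MatrixGroups
open scoped ModularForm Real MatrixGroups Manifold

noncomputable section

/-- `q = e^{2 π i τ}`. -/
def qexp (τ : UpperHalfPlane) : ℂ := Complex.exp (2 * π * Complex.I * τ)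

/-- `f` has the `q`-expansion `∑ c n qⁿ` at `∞`, with only finitely many negative terms. -/
def HasExpansion (f : UpperHalfPlane → ℂ) (c : ℤ → ℂ) : Prop :=
  (∃ N : ℤ, ∀ n : ℤ, n < N → c n = 0) ∧
    ∀ τ : UpperHalfPlane, HasSum (fun n : ℤ => c n * qexp τ ^ n) (f τ)

/-- Weakly holomorphic modular forms of weight `k` on `Γ`, together with their
Fourier coefficients. -/
structure WhmForm (Γ : Subgroup SL(2, ℤ)) (k : ℤ) where
  toFun : UpperHalfPlane → ℂ
  coeff : ℤ → ℂ
  holo : MDifferentiable 𝓘(ℂ) 𝓘(ℂ) toFun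
  slash_eq : ∀ γ ∈ Γ, toFun ∣[k] γ = toFun
  expansion : HasExpansion toFun coeff

/-- `f = q^{-m} + O(q^{ℓ+1})`. -/
def IsBasisElt {Γ : Subgroup SL(2, ℤ)} (k ℓ m : ℤ) (f : WhmForm Γ k) : Prop :=
  f.coeff (-m) = 1 ∧ ∀ n : ℤ, n ≠ -m → n ≤ ℓ → f.coeff n = 0

/-- multiplication of a point of the upper half plane by a positive real number. -/
def rscale (a : ℝ) (ha : 0 < a) (τ : UpperHalfPlane) : UpperHalfPlane :=
  ⟨a * τ, by simpa [Complex.mul_im] using mul_pos ha τ.2⟩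

/-- `τ ↦ -1/τ` on the upper half plane. -/
def neginv (τ : UpperHalfPlane) : UpperHalfPlane :=
  ⟨(-(τ : ℂ))⁻¹, τ.im_inv_neg_coe_pos⟩

/-- `a m n` is the integer Fourier coefficient `a_k(m,n)` of the canonical basis element
`f_{k,m} = q^{-m} + O(q)` (here `ℓ = 0`), with `a m n = 0` out of range. -/
def IsCoeffs (k : ℤ) (a : ℤ → ℤ → ℤ) : Prop :=
  (∀ m : ℤ, 0 ≤ m → ∃ f : WhmForm ⊤ k, IsBasisElt k 0 m f ∧
      ∀ n : ℤ, 0 < n → f.coeff n = (a m n : ℂ)) ∧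
  ∀ m n : ℤ, m < 0 ∨ n ≤ 0 → a m n = 0

open ModularForm in
/-- There are no nonzero level one cusp forms of weight `4, 6, 8, 10` or `14`. -/
theorem cuspForm_eq_zero {k : ℕ} (hk : k ∈ ({4, 6, 8, 10, 14} : Set ℕ))
    (f : CuspForm 𝒮ℒ (k : ℤ)) : f = 0 := by
  have key : Module.rank ℂ (CuspForm 𝒮ℒ (k : ℤ)) = 0 := by
    rcases hk with rfl | rfl | rfl | rfl | rfl
    · exact CuspForm.rank_eq_zero_of_weight_lt_twelve (by norm_num)
    · exact CuspForm.rank_eq_zero_of_weight_lt_twelve (by norm_num)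
    · exact CuspForm.rank_eq_zero_of_weight_lt_twelve (by norm_num)
    · exact CuspForm.rank_eq_zero_of_weight_lt_twelve (by norm_num)
    · exact CuspForm.discriminantEquiv.rank_eq.trans levelOne_weight_two_rank_zero
  exact rank_zero_iff_forall_zero.mp key f

lemma qexp_eq_qParam (τ : ℍ) : qexp τ = Function.Periodic.qParam 1 τ := by
  simp [qexp, Function.Periodic.qParam]

lemma qexp_ne_zero (τ : ℍ) : qexp τ ≠ 0 := Complex.exp_ne_zero _

lemma qexp_T_smul (τ : ℍ) : qexp (ModularGroup.T • τ) = qexp τ := by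
  rw [modular_T_smul, qexp, qexp, coe_vadd, mul_add]
  simp [Complex.exp_add]

open ModularForm in
/-- If a holomorphic function that is invariant under `S` in weight `4, 6, 8, 10` or `14` has an
expansion in positive powers of `q`, all the coefficients are zero. -/
theorem expansion_coeff_eq_zero {k : ℕ} (hk : k ∈ ({4, 6, 8, 10, 14} : Set ℕ))
    {g : ℍ → ℂ} (hol : MDifferentiable 𝓘(ℂ) 𝓘(ℂ) g)
    (hS : g ∣[(k : ℤ)] ModularGroup.S = g) {c : ℕ → ℂ} (hc0 : c 0 = 0)
    (hg : ∀ τ : ℍ, HasSum (fun n : ℕ => c n * qexp τ ^ n) (g τ)) (n : ℕ) : c n = 0 := by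
  have hT : g ∣[(k : ℤ)] ModularGroup.T = g := by
    ext τ
    rw [ModularForm.slash_action_eq'_iff]
    have h1 := hg (ModularGroup.T • τ)
    rw [qexp_T_smul] at h1
    simpa [ModularGroup.T] using h1.unique (hg τ)
  have hinv := SlashInvariantForm.slash_action_generators_SL2Z hS hT
  have hzero : IsZeroAtImInfty g := by
    have hbdd : IsBoundedAtImInfty (fun τ => g τ / qexp τ) := by
      refine isBoundedAtImInfty_of_hasSum_qExpansion (c := fun n => c (n + 1)) one_pos fun τ => ?_
      have h1 := (hasSum_nat_add_iff' 1).mpr (hg τ)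
      simp only [Finset.sum_range_one, hc0, zero_mul, sub_zero] at h1
      convert! h1.div_const (qexp τ) using 2 with m
      rw [← qexp_eq_qParam, smul_eq_mul, pow_succ]
      field_simp [qexp_ne_zero τ]
    have hq : IsZeroAtImInfty qexp :=
      (qParam_tendsto_atImInfty one_pos).congr fun τ => (qexp_eq_qParam τ).symm
    refine (hq.mul_boundedAtFilter hbdd).congr fun τ => ?_
    simp [mul_div_cancel₀ _ (qexp_ne_zero τ)]
  let F : CuspForm 𝒮ℒ (k : ℤ) :=
    { toFun := g
      slash_action_eq' := by rintro _ ⟨γ, rfl⟩; exact hinv γ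
      holo' := hol
      zero_at_cusps' := fun {c} hc => by
        rw [OnePoint.isZeroAt_iff_forall_SL2Z hc]
        intro γ _
        rwa [hinv γ] }
  have hF : F = 0 := cuspForm_eq_zero hk F
  have := ModularFormClass.qExpansion_coeff_unique (f := F) one_pos
    one_mem_strictPeriods_SL (c := c) (fun τ => by
      simp_rw [smul_eq_mul, ← qexp_eq_qParam]; exact hg τ) n
  rw [this, hF]
  simp [qExpansion_zero]

lemma val_coe_SL (γ : SL(2, ℤ)) :
    (γ : GL (Fin 2) ℝ).val = !![(γ 0 0 : ℝ), γ 0 1; γ 1 0, γ 1 1] :=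
  Matrix.eta_fin_two _

section Hecke

variable (p : ℕ) [NeZero p]

/-- The matrix `(1 b; 0 p)`. -/
def shiftMatrix (b : ℤ) : GL (Fin 2) ℝ :=
  .mkOfDetNeZero !![(1 : ℝ), b; 0, p] (by simp [Matrix.det_fin_two, NeZero.ne p])

/-- The matrix `(p 0; 0 1)`. -/
def scaleMatrix : GL (Fin 2) ℝ :=
  .mkOfDetNeZero !![(p : ℝ), 0; 0, 1] (by simp [Matrix.det_fin_two, NeZero.ne p])

lemma det_shiftMatrix (b : ℤ) : (shiftMatrix p b).det.val = p := by
  simp [shiftMatrix, Matrix.GeneralLinearGroup.mkOfDetNeZero, Matrix.det_fin_two]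

lemma det_scaleMatrix : (scaleMatrix p).det.val = p := by
  simp [scaleMatrix, Matrix.GeneralLinearGroup.mkOfDetNeZero, Matrix.det_fin_two]

lemma coe_shiftMatrix_smul (b : ℤ) (τ : ℍ) :
    ((shiftMatrix p b • τ : ℍ) : ℂ) = (τ + b) / p := by
  rw [coe_smul_of_det_pos]
  · simp [shiftMatrix, Matrix.GeneralLinearGroup.mkOfDetNeZero, num, denom]
  · rw [det_shiftMatrix]; exact_mod_cast NeZero.pos p

lemma coe_scaleMatrix_smul (τ : ℍ) : ((scaleMatrix p • τ : ℍ) : ℂ) = p * τ := by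
  rw [coe_smul_of_det_pos]
  · simp [scaleMatrix, Matrix.GeneralLinearGroup.mkOfDetNeZero, num, denom]
  · rw [det_scaleMatrix]; exact_mod_cast NeZero.pos p

lemma slash_shiftMatrix_apply (k : ℕ) (b : ℤ) (f : ℍ → ℂ) (τ : ℍ) :
    (f ∣[(k : ℤ)] shiftMatrix p b) τ = f (shiftMatrix p b • τ) / p := by
  have hp : (p : ℂ) ≠ 0 := NeZero.ne _
  have h0 : (0 : ℝ) < p := by exact_mod_cast NeZero.pos p
  have hd : denom (shiftMatrix p b) τ = p := by
    simp [shiftMatrix, Matrix.GeneralLinearGroup.mkOfDetNeZero, denom]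
  rw [ModularForm.slash_apply, hd, det_shiftMatrix, σ, det_shiftMatrix, if_pos h0, abs_of_pos h0,
    zpow_sub₀ (by exact_mod_cast hp), zpow_neg]
  simp
  field_simp

lemma slash_scaleMatrix_apply {k : ℕ} (hk : 1 ≤ k) (f : ℍ → ℂ) (τ : ℍ) :
    (f ∣[(k : ℤ)] scaleMatrix p) τ = p ^ (k - 1) * f (scaleMatrix p • τ) := by
  have h0 : (0 : ℝ) < p := by exact_mod_cast NeZero.pos p
  have hd : denom (scaleMatrix p) τ = 1 := by
    simp [scaleMatrix, Matrix.GeneralLinearGroup.mkOfDetNeZero, denom]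
  rw [ModularForm.slash_apply, hd, det_scaleMatrix, σ, det_scaleMatrix, if_pos h0, abs_of_pos h0,
    show (k : ℤ) - 1 = ((k - 1 : ℕ) : ℤ) by omega, zpow_natCast]
  simp [mul_comm]

variable {f : ℍ → ℂ} {k : ℤ} (hf : ∀ γ : SL(2, ℤ), f ∣[k] γ = f)

include hf

lemma slash_shiftMatrix_slash_S {b b' c : ℤ} (h : 1 + b * b' = p * c) :
    (f ∣[k] shiftMatrix p b) ∣[k] ModularGroup.S = f ∣[k] shiftMatrix p b' := by
  let γ : SL(2, ℤ) := ⟨!![b, -c; p, -b'], by rw [Matrix.det_fin_two_of]; linarith⟩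
  have hR : (1 : ℝ) + b * b' = p * c := by exact_mod_cast h
  have key : shiftMatrix p b * (ModularGroup.S : GL (Fin 2) ℝ) =
      (γ : GL (Fin 2) ℝ) * shiftMatrix p b' := by
    refine Units.ext ?_
    rw [Units.val_mul, Units.val_mul, val_coe_SL, val_coe_SL]
    ext i j
    fin_cases i <;> fin_cases j <;>
      simp [shiftMatrix, Matrix.GeneralLinearGroup.mkOfDetNeZero, γ, ModularGroup.S,
        Matrix.mul_apply, Fin.sum_univ_two] <;> linarith
  rw [ModularForm.SL_slash, ← SlashAction.slash_mul, key, SlashAction.slash_mul,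
    ← ModularForm.SL_slash, hf]

lemma slash_shiftMatrix_zero_slash_S :
    (f ∣[k] shiftMatrix p 0) ∣[k] ModularGroup.S = f ∣[k] scaleMatrix p := by
  have key : shiftMatrix p 0 * (ModularGroup.S : GL (Fin 2) ℝ) =
      (ModularGroup.S : GL (Fin 2) ℝ) * scaleMatrix p := by
    refine Units.ext ?_
    rw [Units.val_mul, Units.val_mul, val_coe_SL]
    ext i j
    fin_cases i <;> fin_cases j <;>
      simp [shiftMatrix, scaleMatrix, Matrix.GeneralLinearGroup.mkOfDetNeZero, ModularGroup.S,
        Matrix.mul_apply, Fin.sum_univ_two]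
  rw [ModularForm.SL_slash, ← SlashAction.slash_mul, key, SlashAction.slash_mul,
    ← ModularForm.SL_slash, hf]

lemma slash_scaleMatrix_slash_S :
    (f ∣[k] scaleMatrix p) ∣[k] ModularGroup.S = f ∣[k] shiftMatrix p 0 := by
  have key : scaleMatrix p * (ModularGroup.S : GL (Fin 2) ℝ) =
      (ModularGroup.S : GL (Fin 2) ℝ) * shiftMatrix p 0 := by
    refine Units.ext ?_
    rw [Units.val_mul, Units.val_mul, val_coe_SL]
    ext i j
    fin_cases i <;> fin_cases j <;>
      simp [shiftMatrix, scaleMatrix, Matrix.GeneralLinearGroup.mkOfDetNeZero, ModularGroup.S,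
        Matrix.mul_apply, Fin.sum_univ_two]
  rw [ModularForm.SL_slash, ← SlashAction.slash_mul, key, SlashAction.slash_mul,
    ← ModularForm.SL_slash, hf]

omit hf

/-- The Hecke operator `T_p` in weight `k`. -/
def heckeOp (k : ℤ) (f : ℍ → ℂ) : ℍ → ℂ :=
  f ∣[k] scaleMatrix p + ∑ b : ZMod p, f ∣[k] shiftMatrix p b.val

include hf in
lemma heckeOp_slash_S [Fact p.Prime] :
    heckeOp p k f ∣[k] ModularGroup.S = heckeOp p k f := by
  have hb : ∀ b : ZMod p, b ≠ 0 → (f ∣[k] shiftMatrix p b.val) ∣[k] ModularGroup.S =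
      f ∣[k] shiftMatrix p (-b⁻¹).val := by
    intro b hb
    obtain ⟨c, hc⟩ : (p : ℤ) ∣ 1 + (b.val : ℤ) * ((-b⁻¹).val : ℤ) := by
      rw [← ZMod.intCast_zmod_eq_zero_iff_dvd]
      simp [mul_inv_cancel₀ hb]
    exact slash_shiftMatrix_slash_S p hf hc
  rw [heckeOp, SlashAction.add_slash, SlashAction.sum_slash, slash_scaleMatrix_slash_S p hf,
    ← Finset.add_sum_erase _ _ (Finset.mem_univ (0 : ZMod p)),
    ← Finset.add_sum_erase _ _ (Finset.mem_univ (0 : ZMod p))]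
  simp only [ZMod.val_zero, Nat.cast_zero, slash_shiftMatrix_zero_slash_S p hf]
  rw [add_left_comm]
  congr 2
  refine Finset.sum_nbij' (fun b => -b⁻¹) (fun b => -b⁻¹) ?_ ?_ ?_ ?_ ?_
  · simp
  · simp
  · simp [inv_neg]
  · simp [inv_neg]
  · exact fun b h => hb b (Finset.ne_of_mem_erase h)

lemma mdifferentiable_heckeOp (hol : MDifferentiable 𝓘(ℂ) 𝓘(ℂ) f) :
    MDifferentiable 𝓘(ℂ) 𝓘(ℂ) (heckeOp p k f) := by
  refine (hol.slash k _).add ?_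
  exact MDifferentiable.sum fun b _ => hol.slash k _

lemma sum_zmod_val {M : Type*} [AddCommMonoid M] (h : ℕ → M) :
    ∑ b : ZMod p, h b.val = ∑ b ∈ Finset.range p, h b := by
  obtain ⟨q, rfl⟩ : ∃ q, p = q + 1 := ⟨p - 1, (Nat.succ_pred (NeZero.ne p)).symm⟩
  exact (Finset.sum_range h).symm

omit [NeZero p] in
lemma sum_root_zpow {ζ : ℂ} (hζ : IsPrimitiveRoot ζ p) (n : ℤ) :
    ∑ b ∈ Finset.range p, (ζ ^ b) ^ n = if (p : ℤ) ∣ n then (p : ℂ) else 0 := by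
  have h : ∀ b : ℕ, (ζ ^ b) ^ n = (ζ ^ n) ^ b := fun b => by
    rw [← zpow_natCast, ← zpow_natCast, ← zpow_mul, ← zpow_mul, mul_comm]
  simp_rw [h]
  split_ifs with hn
  · simp [(hζ.zpow_eq_one_iff_dvd n).mpr hn]
  · rw [geom_sum_eq (mt (hζ.zpow_eq_one_iff_dvd n).mp hn), ← h, hζ.pow_eq_one]
    simp

lemma qexp_scaleMatrix_smul (τ : ℍ) : qexp (scaleMatrix p • τ) = qexp τ ^ p := by
  rw [qexp, qexp, coe_scaleMatrix_smul, ← Complex.exp_nat_mul]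
  congr 1
  ring

lemma qexp_shiftMatrix_smul (b : ℕ) (τ : ℍ) : qexp (shiftMatrix p b • τ) =
    Complex.exp (2 * π * Complex.I * τ / p) * Complex.exp (2 * π * Complex.I / p) ^ b := by
  rw [qexp, coe_shiftMatrix_smul, ← Complex.exp_nat_mul, ← Complex.exp_add]
  congr 1
  push_cast
  ring

lemma hasSum_slash_scaleMatrix {k : ℕ} (hk : 1 ≤ k) {c : ℤ → ℂ}
    (hc : ∀ τ : ℍ, HasSum (fun n : ℤ => c n * qexp τ ^ n) (f τ)) (τ : ℍ) :
    HasSum (fun n : ℤ => (if (p : ℤ) ∣ n then (p : ℂ) ^ (k - 1) * c (n / p) else 0) * qexp τ ^ n)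
      ((f ∣[(k : ℤ)] scaleMatrix p) τ) := by
  have hp : (p : ℤ) ≠ 0 := NeZero.ne _
  rw [slash_scaleMatrix_apply p hk, ← (mul_right_injective₀ hp).hasSum_iff]
  · convert! (hc (scaleMatrix p • τ)).mul_left ((p : ℂ) ^ (k - 1)) using 2 with n
    simp [qexp_scaleMatrix_smul, Int.mul_ediv_cancel_left _ hp, zpow_mul, mul_assoc]
  · intro n hn
    rw [if_neg fun ⟨d, hd⟩ => hn ⟨d, hd.symm⟩, zero_mul]

lemma hasSum_sum_slash_shiftMatrix {k : ℕ} {c : ℤ → ℂ}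
    (hc : ∀ τ : ℍ, HasSum (fun n : ℤ => c n * qexp τ ^ n) (f τ)) (τ : ℍ) :
    HasSum (fun n : ℤ => c (p * n) * qexp τ ^ n)
      ((∑ b : ZMod p, f ∣[(k : ℤ)] shiftMatrix p b.val) τ) := by
  have hp : (p : ℤ) ≠ 0 := NeZero.ne _
  have hpC : (p : ℂ) ≠ 0 := NeZero.ne _
  set Q := Complex.exp (2 * π * Complex.I * τ / p) with hQ
  have hQp : Q ^ p = qexp τ := by
    rw [hQ, ← Complex.exp_nat_mul, qexp]
    congr 1
    field_simp
  have h := hasSum_sum (s := Finset.range p) fun b _ =>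
    (hc (shiftMatrix p b • τ)).div_const (p : ℂ)
  have hterm : ∀ n : ℤ, ∑ b ∈ Finset.range p, c n * qexp (shiftMatrix p b • τ) ^ n / p =
      if (p : ℤ) ∣ n then c n * Q ^ n else 0 := by
    intro n
    simp_rw [qexp_shiftMatrix_smul, mul_zpow, ← Finset.sum_div, ← mul_assoc, ← Finset.mul_sum]
    rw [sum_root_zpow p (Complex.isPrimitiveRoot_exp p (NeZero.ne p))]
    split_ifs
    · field_simp
      rfl
    · simp
  simp_rw [hterm] at h
  rw [← (mul_right_injective₀ hp).hasSum_iff] at h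
  · convert! h using 2 with n
    · simp [zpow_mul, hQp]
    · rw [Finset.sum_apply, ← sum_zmod_val]
      simp_rw [slash_shiftMatrix_apply]
  · intro n hn
    rw [if_neg fun ⟨d, hd⟩ => hn ⟨d, hd.symm⟩]

lemma hasSum_heckeOp {k : ℕ} (hk : 1 ≤ k) {c : ℤ → ℂ}
    (hc : ∀ τ : ℍ, HasSum (fun n : ℤ => c n * qexp τ ^ n) (f τ)) (τ : ℍ) :
    HasSum (fun n : ℤ =>
      (c (p * n) + if (p : ℤ) ∣ n then (p : ℂ) ^ (k - 1) * c (n / p) else 0) * qexp τ ^ n)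
      (heckeOp p k f τ) := by
  convert! (hasSum_slash_scaleMatrix p hk hc τ).add
    (hasSum_sum_slash_shiftMatrix p (k := k) hc τ) using 2 with n
  ring

end Hecke

/-- If the coefficients of `T_p f₀` and `x f₁ + y f₂` agree in nonpositive degrees, they agree. -/
theorem heckeOp_coeff_eq {p : ℕ} [Fact p.Prime] {k : ℕ} (hk : k ∈ ({4, 6, 8, 10, 14} : Set ℕ))
    (f₀ f₁ f₂ : WhmForm ⊤ k) (x y : ℂ)
    (h : ∀ n : ℤ, n ≤ 0 →
      (f₀.coeff (p * n) + if (p : ℤ) ∣ n then (p : ℂ) ^ (k - 1) * f₀.coeff (n / p) else 0) =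
        x * f₁.coeff n + y * f₂.coeff n) (n : ℤ) :
    (f₀.coeff (p * n) + if (p : ℤ) ∣ n then (p : ℂ) ^ (k - 1) * f₀.coeff (n / p) else 0) =
      x * f₁.coeff n + y * f₂.coeff n := by
  have hk1 : 1 ≤ k := by rcases hk with rfl | rfl | rfl | rfl | rfl <;> norm_num
  set d : ℤ → ℂ := fun n =>
    (f₀.coeff (p * n) + if (p : ℤ) ∣ n then (p : ℂ) ^ (k - 1) * f₀.coeff (n / p) else 0) -
      (x * f₁.coeff n + y * f₂.coeff n) with hd
  have hd0 : ∀ n ≤ 0, d n = 0 := fun n hn => sub_eq_zero.mpr (h n hn)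
  rcases le_or_gt n 0 with hn | hn
  · exact h n hn
  set g : ℍ → ℂ := heckeOp p k f₀.toFun - (x • f₁.toFun + y • f₂.toFun) with hg
  have hsum : ∀ τ : ℍ, HasSum (fun n : ℤ => d n * qexp τ ^ n) (g τ) := fun τ => by
    convert! (hasSum_heckeOp p hk1 f₀.expansion.2 τ).sub
      (((f₁.expansion.2 τ).mul_left x).add ((f₂.expansion.2 τ).mul_left y)) using 2 with n
    simp only [hd]
    ring
  have hsumNat : ∀ τ : ℍ, HasSum (fun n : ℕ => d n * qexp τ ^ n) (g τ) := fun τ => by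
    have := hsum τ
    rw [← (Nat.cast_injective (R := ℤ)).hasSum_iff] at this
    · simpa [Function.comp_def] using this
    · intro n hn
      rw [hd0 n, zero_mul]
      by_contra! hlt
      exact hn ⟨n.toNat, Int.toNat_of_nonneg hlt.le⟩
  have hol : MDifferentiable 𝓘(ℂ) 𝓘(ℂ) g :=
    (mdifferentiable_heckeOp p f₀.holo).sub
      ((f₁.holo.const_smul x).add (f₂.holo.const_smul y))
  have hS : g ∣[(k : ℤ)] ModularGroup.S = g := by
    rw [hg, sub_eq_add_neg, SlashAction.add_slash, SlashAction.neg_slash, SlashAction.add_slash,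
      ModularForm.SL_smul_slash, ModularForm.SL_smul_slash, f₁.slash_eq _ trivial,
      f₂.slash_eq _ trivial, heckeOp_slash_S p fun γ => f₀.slash_eq γ trivial]
  have := expansion_coeff_eq_zero hk hol hS (c := fun n => d n) (hd0 0 le_rfl) hsumNat n.toNat
  rw [Int.toNat_of_nonneg hn.le] at this
  exact sub_eq_zero.mp this

lemma IsBasisElt.coeff_eq {Γ : Subgroup SL(2, ℤ)} {k m : ℤ} {f : WhmForm Γ k}
    (hf : IsBasisElt k 0 m f) {n : ℤ} (hn : n ≤ 0) : f.coeff n = if n = -m then 1 else 0 := by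
  split_ifs with h
  · rw [h, hf.1]
  · exact hf.2 n h hn

lemma Int.mul_eq_neg_iff_dvd {p j m : ℤ} (hp : p ≠ 0) : p * j = -m ↔ p ∣ m ∧ j = -(m / p) := by
  constructor
  · intro h
    obtain rfl : m = p * -j := by linarith
    rw [Int.mul_ediv_cancel_left _ hp]
    exact ⟨dvd_mul_right _ _, (neg_neg j).symm⟩
  · rintro ⟨⟨d, rfl⟩, rfl⟩
    rw [Int.mul_ediv_cancel_left _ hp, mul_neg]

lemma Int.eq_neg_mul_iff_dvd {p j m : ℤ} (hp : p ≠ 0) : j = -(p * m) ↔ p ∣ j ∧ j / p = -m := by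
  constructor
  · rintro rfl
    rw [← mul_neg, Int.mul_ediv_cancel_left _ hp]
    exact ⟨dvd_mul_right _ _, rfl⟩
  · rintro ⟨⟨d, rfl⟩, h⟩
    rw [Int.mul_ediv_cancel_left _ hp] at h
    rw [h, mul_neg]

/-- The Hecke recursion for the coefficients of the canonical basis. -/
theorem IsCoeffs.hecke {p : ℕ} [hp : Fact p.Prime] {k : ℕ}
    (hk : k ∈ ({4, 6, 8, 10, 14} : Set ℕ)) {a : ℤ → ℤ → ℤ} (ha : IsCoeffs k a)
    {m n : ℤ} (hm : 0 < m) (hn : 0 < n) :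
    a m (p * n) + (if (p : ℤ) ∣ n then (p : ℤ) ^ (k - 1) * a m (n / p) else 0) =
      (p : ℤ) ^ (k - 1) * a (p * m) n + if (p : ℤ) ∣ m then a (m / p) n else 0 := by
  have hp0 : (0 : ℤ) < p := by exact_mod_cast hp.out.pos
  obtain ⟨f₀, hf₀, h₀⟩ := ha.1 m hm.le
  obtain ⟨f₁, hf₁, h₁⟩ := ha.1 (p * m) (by positivity)
  obtain ⟨f₂, hf₂, h₂⟩ := ha.1 (m / p) (Int.ediv_nonneg hm.le hp0.le)
  have key := heckeOp_coeff_eq hk (p := p) f₀ f₁ f₂ ((p : ℂ) ^ (k - 1))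
    (if (p : ℤ) ∣ m then 1 else 0) (fun j hj => by
      rw [hf₀.coeff_eq (mul_nonpos_of_nonneg_of_nonpos hp0.le hj),
        hf₀.coeff_eq (Int.ediv_nonpos_of_nonpos_of_neg hj hp0), hf₁.coeff_eq hj, hf₂.coeff_eq hj]
      simp only [Int.mul_eq_neg_iff_dvd hp0.ne', Int.eq_neg_mul_iff_dvd hp0.ne', ite_and]
      split_ifs <;> ring) n
  have hnp : (p : ℤ) ∣ n → 0 < n / p := fun h => Int.ediv_pos_of_pos_of_dvd hn hp0.le h
  rw [h₀ _ (by positivity), h₁ _ hn, h₂ _ hn] at key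
  split_ifs at key ⊢ with hpn hpm hpm
  · rw [h₀ _ (hnp hpn), one_mul] at key
    exact_mod_cast key
  · rw [h₀ _ (hnp hpn), zero_mul] at key
    exact_mod_cast key
  · rw [one_mul] at key
    exact_mod_cast key
  · rw [zero_mul] at key
    exact_mod_cast key

section Recursion

variable {P : ℤ} {A : ℕ → ℕ → ℤ}

/-- A telescoped form of the Hecke recursion along powers of a prime. -/
lemma recursion_succ_succ (h1 : ∀ r, A (r + 1) 1 = P * A (r + 2) 0 + A r 0)
    (h : ∀ r s, A (r + 1) (s + 2) + P * A (r + 1) s = P * A (r + 2) (s + 1) + A r (s + 1))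
    (r s : ℕ) : A (r + 1) (s + 1) = A r s + P ^ (s + 1) * A (r + s + 2) 0 := by
  induction s generalizing r with
  | zero => rw [h1]; ring_nf
  | succ s ih =>
    have e := h r s
    rw [ih (r + 1)] at e
    rw [show r + (s + 1) + 2 = r + 1 + s + 2 by ring]
    linear_combination e

lemma recursion_zero_left (h00 : A 0 1 = P * A 1 0)
    (h0 : ∀ s, A 0 (s + 2) + P * A 0 s = P * A 1 (s + 1))
    (hA : ∀ r s, A (r + 1) (s + 1) = A r s + P ^ (s + 1) * A (r + s + 2) 0) (s : ℕ) :
    A 0 s = P ^ s * A s 0 := by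
  rcases s with _ | _ | s
  · simp
  · simpa using h00
  · have e := h0 s
    rw [hA, zero_add] at e
    linear_combination e

lemma recursion_dvd {D : ℤ} (hD : ∀ r, D ∣ A (r + 1) 0) (h0 : ∀ s, A 0 s = P ^ s * A s 0)
    (hA : ∀ r s, A (r + 1) (s + 1) = A r s + P ^ (s + 1) * A (r + s + 2) 0) (r s : ℕ) :
    (s < r → D ∣ A r s) ∧ (r < s → P ^ (s - r) * D ∣ A r s) := by
  induction r generalizing s with
  | zero =>
    refine ⟨fun h => absurd h (Nat.not_lt_zero s), fun h => ?_⟩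
    obtain ⟨s, rfl⟩ := Nat.exists_eq_succ_of_ne_zero h.ne'
    rw [h0]
    exact mul_dvd_mul_left _ (hD s)
  | succ r ih =>
    rcases s with _ | s
    · exact ⟨fun _ => hD r, fun h => absurd h (Nat.not_lt_zero _)⟩
    · rw [hA, Nat.add_sub_add_right]
      exact ⟨fun h => dvd_add ((ih s).1 (by omega)) (dvd_mul_of_dvd_right (hD _) _),
        fun h => dvd_add ((ih s).2 (by omega)) (mul_dvd_mul (pow_dvd_pow _ (by omega)) (hD _))⟩

end Recursion

/-- Reduction step: divisibility for `p ∣ a`, `p ∤ b` implies the general divisibility. -/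
theorem stmt_8 (p : ℕ) (hp : p ∈ ({2, 3, 5} : Set ℕ)) (k : ℕ)
    (hk : k ∈ ({4, 6, 8, 10, 14} : Set ℕ))
    (a : ℤ → ℤ → ℤ) (ha : IsCoeffs k a) (ε : ℕ)
    (hdvd : ∀ A B : ℤ, 0 < A → 0 < B → (p : ℤ) ∣ A → ¬ (p : ℤ) ∣ B →
      (p : ℤ) ^ ε ∣ a A B)
    (m n : ℤ) (hm : 0 < m) (hn : 0 < n) (hmp : ¬ (p : ℤ) ∣ m) (hnp : ¬ (p : ℤ) ∣ n)
    (r s : ℕ) :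
    (s < r → (p : ℤ) ^ ε ∣ a (m * p ^ r) (n * p ^ s)) ∧
    (r < s → (p : ℤ) ^ ((s - r) * (k - 1) + ε) ∣ a (m * p ^ r) (n * p ^ s)) := by
  have hpr : p.Prime := by rcases hp with rfl | rfl | rfl <;> norm_num
  have : Fact p.Prime := ⟨hpr⟩
  have hp0 : (0 : ℤ) < p := by exact_mod_cast hpr.pos
  set A : ℕ → ℕ → ℤ := fun r s => a (m * p ^ r) (n * p ^ s) with hA
  set P : ℤ := (p : ℤ) ^ (k - 1) with hP
  have hecke : ∀ r s : ℕ, A r (s + 1) +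
      (if (p : ℤ) ∣ n * p ^ s then P * a (m * p ^ r) (n * p ^ s / p) else 0) =
        P * A (r + 1) s +
          if (p : ℤ) ∣ m * p ^ r then a (m * p ^ r / p) (n * p ^ s) else 0 := fun r s => by
    have e := ha.hecke (p := p) hk (m := m * p ^ r) (n := n * p ^ s) (by positivity)
      (by positivity)
    rwa [show (p : ℤ) * (n * p ^ s) = n * p ^ (s + 1) by ring,
      show (p : ℤ) * (m * p ^ r) = m * p ^ (r + 1) by ring] at e
  have hdiv : ∀ (x : ℤ) (j : ℕ), (p : ℤ) ∣ x * p ^ (j + 1) ∧ x * p ^ (j + 1) / p = x * p ^ j :=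
    fun x j => by
      rw [show x * (p : ℤ) ^ (j + 1) = p * (x * p ^ j) by ring]
      exact ⟨dvd_mul_right _ _, Int.mul_ediv_cancel_left _ hp0.ne'⟩
  have h00 : A 0 1 = P * A 1 0 := by simpa [hmp, hnp] using hecke 0 0
  have h0 : ∀ s, A 0 (s + 2) + P * A 0 s = P * A 1 (s + 1) := fun s => by
    have e := hecke 0 (s + 1)
    rw [if_pos (hdiv n s).1, (hdiv n s).2, if_neg (by simpa using hmp), add_zero] at e
    exact e
  have h1 : ∀ r, A (r + 1) 1 = P * A (r + 2) 0 + A r 0 := fun r => by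
    have e := hecke (r + 1) 0
    rw [if_pos (hdiv m r).1, (hdiv m r).2, if_neg (by simpa using hnp), add_zero] at e
    exact e
  have h2 : ∀ r s, A (r + 1) (s + 2) + P * A (r + 1) s =
      P * A (r + 2) (s + 1) + A r (s + 1) := fun r s => by
    have e := hecke (r + 1) (s + 1)
    rw [if_pos (hdiv n s).1, (hdiv n s).2, if_pos (hdiv m r).1, (hdiv m r).2] at e
    exact e
  have hsucc := recursion_succ_succ h1 h2
  have hD : ∀ r, (p : ℤ) ^ ε ∣ A (r + 1) 0 := fun r =>
    hdvd _ _ (by positivity) (by positivity) (hdiv m r).1 (by simpa using hnp)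
  have key := recursion_dvd hD (recursion_zero_left h00 h0 hsucc) hsucc r s
  rwa [hP, ← pow_mul, ← pow_add, mul_comm (k - 1)] at key
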